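/- Let n > 1 and let x, y ∈ ℝ_+^n have all entries strictly positive, with minimum entries x_min and y_min satisfying x_min > y_min > 0. Set s = (log n)/(log x_min − log y_min). Then ‖x‖_p > ‖y‖_p for every p < −s. -/

import Mathlib

open Finset

/-- Scaled p-norm: `((1/n) Σ xᵢ^p)^(1/p)`, with the convention that it is `0`
for `p < 0` when some entry is zero. -/
noncomputable def snorm {n : ℕ} (p : ℝ) (x : Fin n → ℝ) : ℝ :=
  if p < 0 ∧ ∃ i, x i = 0 then 0
  else ((1 / (n : ℝ)) * ∑ i, x i ^ p) ^ (1 / p)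

/-- `F_{k,r}(x)`: sum over tuples `(k₁,…,kₙ)` of nonnegative integers with `Σ kᵢ = k`
and `max kᵢ ≤ r` of `Π xᵢ^{kᵢ}/kᵢ!`. -/
noncomputable def Fpoly {n : ℕ} (k r : ℕ) (x : Fin n → ℝ) : ℝ :=
  ∑ κ ∈ Finset.univ.filter (fun κ : Fin n → Fin (r + 1) => ∑ i, (κ i : ℕ) = k),
    ∏ i, x i ^ (κ i : ℕ) / (Nat.factorial (κ i))

/-- Shannon entropy. -/
noncomputable def H1 {n : ℕ} (x : Fin n → ℝ) : ℝ := -∑ i, x i * Real.log (x i)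

/-- Rényi entropy of order `p ∉ {0,1}`. -/
noncomputable def Hp {n : ℕ} (p : ℝ) (x : Fin n → ℝ) : ℝ :=
  (Real.sign p / (1 - p)) * Real.log (∑ i, x i ^ p)

/-- Classical Rényi divergence of order `p` (KL divergence at `p = 1`). -/
noncomputable def Dp {n : ℕ} (p : ℝ) (x g : Fin n → ℝ) : ℝ :=
  if p = 1 then ∑ i, x i * Real.log (x i / g i)
  else (Real.sign p / (p - 1)) * Real.log (∑ i, x i ^ p * g i ^ (1 - p))

/-- Probability vector: nonnegative entries summing to one. -/
def ProbVec {n : ℕ} (x : Fin n → ℝ) : Prop := (∀ i, 0 ≤ x i) ∧ ∑ i, x i = 1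

/-- `x` is the embedding of `q` via `ν`: each value `qᵢ/νᵢ` is repeated `νᵢ` times. -/
def IsEmbedding {d N : ℕ} (ν : Fin d → ℕ) (q : Fin d → ℝ) (x : Fin N → ℝ) : Prop :=
  ∃ f : Fin N → Fin d,
    (∀ j, x j = q (f j) / (ν (f j) : ℝ)) ∧
    (∀ i, (Finset.univ.filter (fun j => f j = i)).card = ν i)

theorem stmt2 {n : ℕ} (hn : 1 < n) (x y : Fin n → ℝ)
    (hx : ∀ i, 0 < x i) (hy : ∀ i, 0 < y i)
    (xmin ymin : ℝ) (hxmin : IsLeast (Set.range x) xmin) (hymin : IsLeast (Set.range y) ymin)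
    (hgt : xmin > ymin) (hpos : ymin > 0)
    (s : ℝ) (hs : s = Real.log n / (Real.log xmin - Real.log ymin)) :
    ∀ p : ℝ, p < -s → snorm p x > snorm p y := by
  intro p hp
  have hn0 : (0:ℝ) < n := by exact_mod_cast (by omega : 0 < n)
  have hn1 : (1:ℝ) < n := by exact_mod_cast hn
  have hxp : 0 < xmin := lt_trans hpos hgt
  have hL : 0 < Real.log xmin - Real.log ymin := sub_pos.mpr (Real.log_lt_log hpos hgt)
  have hs0 : 0 < s := by
    rw [hs]
    exact div_pos (Real.log_pos hn1) hL
  have hp0 : p < 0 := by linarith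
  have hsl : s * (Real.log xmin - Real.log ymin) = Real.log n := by
    rw [hs]
    field_simp
  have h1 : ∑ i, x i ^ p ≤ n * xmin ^ p := by
    have h : ∀ i ∈ (Finset.univ : Finset (Fin n)), x i ^ p ≤ xmin ^ p := fun i _ =>
      Real.rpow_le_rpow_of_nonpos hxp (hxmin.2 ⟨i, rfl⟩) hp0.le
    simpa using Finset.sum_le_sum h
  have h2 : (n:ℝ) * xmin ^ p < ymin ^ p := by
    have ha : 0 < xmin ^ p := Real.rpow_pos_of_pos hxp p
    have hb : 0 < ymin ^ p := Real.rpow_pos_of_pos hpos p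
    apply (Real.log_lt_log_iff (mul_pos hn0 ha) hb).mp
    rw [Real.log_mul hn0.ne' ha.ne', Real.log_rpow hxp, Real.log_rpow hpos]
    nlinarith
  have h3 : ymin ^ p ≤ ∑ i, y i ^ p := by
    obtain ⟨j, hj⟩ := hymin.1
    rw [← hj]
    exact Finset.single_le_sum (f := fun i => y i ^ p)
      (fun i _ => (Real.rpow_pos_of_pos (hy i) p).le) (Finset.mem_univ j)
  have h4 : 0 < ∑ i, x i ^ p := by
    obtain ⟨j, hj⟩ := hxmin.1
    exact Finset.sum_pos (fun i _ => Real.rpow_pos_of_pos (hx i) p) ⟨j, Finset.mem_univ j⟩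
  have hxe : ¬ (p < 0 ∧ ∃ i, x i = 0) := fun ⟨_, i, hi⟩ => (hx i).ne' hi
  have hye : ¬ (p < 0 ∧ ∃ i, y i = 0) := fun ⟨_, i, hi⟩ => (hy i).ne' hi
  unfold snorm
  rw [if_neg hxe, if_neg hye]
  have hi : 0 < 1 / (n:ℝ) := by positivity
  exact Real.rpow_lt_rpow_of_neg (mul_pos hi h4)
    (mul_lt_mul_of_pos_left (by linarith) hi) (one_div_neg.mpr hp0)
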